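/- Handling bias in concentration inequalities: assume Z finite, the low-density condition P_{X∼ρ_X}(d(g*(X),F) < t) ≤ c_α t^α for all t > 0, and that for some ε₀ > 0, for all x ∈ supp ρ_X and all t > 0, P(‖g_n(ω,x) − g*(x)‖ > t) ≤ 1{t < ε₀}. Then E_ω[R(f_n(ω))] − R(f*) ≤ 2 c_ψ c_α ε₀^{α+1}. -/

import Mathlib

open MeasureTheory ProbabilityTheory Real
open scoped RealInnerProductSpace ENNReal

noncomputable section

variable {X Y Z H Ω : Type*}
variable [TopologicalSpace X] [PolishSpace X] [MeasurableSpace X] [BorelSpace X]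
variable [MeasurableSpace Y] [MeasurableSpace Ω]
variable [Fintype Z] [Nonempty Z] [MeasurableSpace Z] [MeasurableSingletonClass Z]
variable [NormedAddCommGroup H] [InnerProductSpace ℝ H] [CompleteSpace H]
variable [SecondCountableTopology H] [MeasurableSpace H] [BorelSpace H]

/-- The risk of a predictor `f : X → Z` for the loss `ℓ(z, y) = ⟪ψ z, φ y⟫`. -/
def risk (ψ : Z → H) (φ : Y → H) (ρ : Measure (X × Y)) (f : X → Z) : ℝ :=
  ∫ p, ⟪ψ (f p.1), φ p.2⟫ ∂ρ

/-- The surrogate conditional mean `g*(x) = E_{Y ∼ ρ|ₓ}[φ(Y)]`, where `κ x = ρ|ₓ`. -/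
def gStar (φ : Y → H) (κ : Kernel X Y) (x : X) : H :=
  ∫ y, φ y ∂(κ x)

/-- `f` is a (measurable) decoding of `g : X → H`. -/
def IsDecoding (ψ : Z → H) (g : X → H) (f : X → Z) : Prop :=
  Measurable f ∧ ∀ x z, ⟪ψ (f x), g x⟫ ≤ ⟪ψ z, g x⟫

/-- The decision frontier `F`. -/
def decisionFrontier (ψ : Z → H) : Set H :=
  {ξ | ∃ z₁ z₂ : Z, z₁ ≠ z₂ ∧ (∀ z, ⟪ψ z₁, ξ⟫ ≤ ⟪ψ z, ξ⟫) ∧ ∀ z, ⟪ψ z₂, ξ⟫ ≤ ⟪ψ z, ξ⟫}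

/-- Distance (in `ℝ≥0∞`) from a point to the decision frontier. -/
def dF (ψ : Z → H) (ξ : H) : ℝ≥0∞ :=
  EMetric.infEdist ξ (decisionFrontier ψ)

/-- The (topological) support of a measure: points all of whose neighborhoods have
positive mass. -/
def msupp (μ : Measure X) : Set X :=
  {x | ∀ U : Set X, IsOpen U → x ∈ U → 0 < μ U}

theorem aux_dF_le (ψ : Z → H) (a b : H) (z₁ z₂ : Z) (hne : z₁ ≠ z₂)
    (h1 : ∀ z, ⟪ψ z₁, a⟫ ≤ ⟪ψ z, a⟫) (h2 : ∀ z, ⟪ψ z₂, b⟫ ≤ ⟪ψ z, b⟫) :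
    dF ψ a ≤ ENNReal.ofReal ‖b - a‖ := by
  classical
  let C : Z → Set H := fun w => {ξ | ∀ z, ⟪ψ w, ξ⟫ ≤ ⟪ψ z, ξ⟫}
  have hC : ∀ w, IsClosed (C w) := by
    intro w
    have : C w = ⋂ z, {ξ | ⟪ψ w, ξ⟫ ≤ ⟪ψ z, ξ⟫} := by
      ext ξ; simp [C]
    rw [this]
    exact isClosed_iInter fun z => isClosed_le (by fun_prop) (by fun_prop)
  have hD : IsClosed (⋃ w ∈ {w : Z | w ≠ z₁}, C w) :=
    Set.Finite.isClosed_biUnion (Set.toFinite _) fun w _ => hC w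
  have hpre : IsPreconnected (segment ℝ a b) := (convex_segment a b).isPreconnected
  obtain ⟨ξ, hξs, hξ1, hξ2⟩ := isPreconnected_closed_iff.1 hpre (C z₁) _ (hC z₁) hD
    (by
      intro ξ _
      obtain ⟨w, hw⟩ := Finite.exists_min (fun z => ⟪ψ z, ξ⟫)
      by_cases h : w = z₁
      · left; subst h; exact hw
      · right; exact Set.mem_biUnion (show w ∈ {w : Z | w ≠ z₁} from h) hw)
    ⟨a, left_mem_segment ℝ a b, h1⟩
    ⟨b, right_mem_segment ℝ a b, Set.mem_biUnion (show z₂ ∈ {w : Z | w ≠ z₁} from hne.symm) h2⟩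
  simp only [Set.mem_iUnion] at hξ2
  obtain ⟨w, hw, hwC⟩ := hξ2
  have hF : ξ ∈ decisionFrontier ψ := ⟨z₁, w, fun h => hw h.symm, hξ1, hwC⟩
  refine (Metric.infEDist_le_edist_of_mem hF).trans ?_
  rw [edist_dist]
  apply ENNReal.ofReal_le_ofReal
  have := dist_add_dist_of_mem_segment hξs
  rw [← dist_eq_norm b a, dist_comm b a]
  linarith [dist_nonneg (x := ξ) (y := b)]

theorem aux_msupp (μ : Measure X) : ∀ᵐ x ∂μ, x ∈ msupp μ := by
  rw [ae_iff]
  refine measure_null_of_locally_null _ fun x hx => ?_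
  simp only [msupp, Set.mem_setOf_eq, not_forall, not_lt, nonpos_iff_eq_zero] at hx
  obtain ⟨U, hU, hxU, h0⟩ := hx
  exact ⟨U, mem_nhdsWithin_of_mem_nhds (hU.mem_nhds hxU), h0⟩

theorem aux_gStar_meas (φ : Y → H) (hφ : Measurable φ) (κ : Kernel X Y) [IsMarkovKernel κ] :
    Measurable (gStar φ κ) :=
  (StronglyMeasurable.integral_kernel (κ := κ) hφ.stronglyMeasurable).measurable

theorem aux_phi_int (φ : Y → H) (hφ : Measurable φ)
    (μ : Measure X) [IsProbabilityMeasure μ] (κ : Kernel X Y) [IsMarkovKernel κ]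
    (hφ2 : Integrable (fun p : X × Y => ‖φ p.2‖ ^ 2) (μ ⊗ₘ κ)) :
    Integrable (fun p : X × Y => φ p.2) (μ ⊗ₘ κ) := by
  have hm : AEStronglyMeasurable (fun p : X × Y => φ p.2) (μ ⊗ₘ κ) :=
    (hφ.comp measurable_snd).aestronglyMeasurable
  exact ((memLp_two_iff_integrable_sq_norm hm).2 hφ2).integrable (by norm_num)

theorem aux_loss_int (ψ : Z → H) (φ : Y → H) (cψ : ℝ) (hψ : ∀ z, ‖ψ z‖ ≤ cψ)
    (hφ : Measurable φ)
    (μ : Measure X) [IsProbabilityMeasure μ] (κ : Kernel X Y) [IsMarkovKernel κ]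
    (hi : Integrable (fun p : X × Y => φ p.2) (μ ⊗ₘ κ)) (f : X → Z) (hf : Measurable f) :
    Integrable (fun p : X × Y => ⟪ψ (f p.1), φ p.2⟫) (μ ⊗ₘ κ) := by
  have hψm : Measurable ψ := measurable_of_finite ψ
  refine (hi.norm.const_mul cψ).mono' ?_ ?_
  · exact (((hψm.comp (hf.comp measurable_fst)).inner
      (hφ.comp measurable_snd))).aestronglyMeasurable
  · refine Filter.Eventually.of_forall fun p => ?_
    exact (norm_inner_le_norm _ _).trans
      (mul_le_mul_of_nonneg_right (hψ _) (norm_nonneg _))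

theorem aux_risk (ψ : Z → H) (φ : Y → H) (cψ : ℝ) (hψ : ∀ z, ‖ψ z‖ ≤ cψ) (hφ : Measurable φ)
    (μ : Measure X) [IsProbabilityMeasure μ] (κ : Kernel X Y) [IsMarkovKernel κ]
    (hi : Integrable (fun p : X × Y => φ p.2) (μ ⊗ₘ κ)) (f : X → Z) (hf : Measurable f) :
    Integrable (fun x => ⟪ψ (f x), gStar φ κ x⟫) μ ∧
    risk ψ φ (μ ⊗ₘ κ) f = ∫ x, ⟪ψ (f x), gStar φ κ x⟫ ∂μ := by
  have hl := aux_loss_int ψ φ cψ hψ hφ μ κ hi f hf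
  have hψm : Measurable ψ := measurable_of_finite ψ
  have hi' := (Measure.integrable_compProd_iff hi.aestronglyMeasurable).1 hi
  constructor
  · refine (hi'.2.const_mul cψ).mono' ?_ ?_
    · exact ((hψm.comp hf).inner (aux_gStar_meas φ hφ κ)).aestronglyMeasurable
    · refine Filter.Eventually.of_forall fun x => ?_
      refine (norm_inner_le_norm _ _).trans ?_
      exact mul_le_mul (hψ _) (norm_integral_le_integral_norm _) (norm_nonneg _)
        ((norm_nonneg _).trans (hψ (f x)))
  · unfold risk
    rw [Measure.integral_compProd hl]
    refine integral_congr_ae ?_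
    filter_upwards [hi'.1] with x hx
    exact integral_inner hx (ψ (f x))

theorem aux_low (ψ : Z → H) (g : X → H) (μ : Measure X) (α cα : ℝ) (hcα : 0 < cα)
    (hlow : ∀ t : ℝ, 0 < t →
      μ {x | dF ψ (g x) < ENNReal.ofReal t} ≤ ENNReal.ofReal (cα * t ^ α))
    (ε₀ : ℝ) (hε₀ : 0 < ε₀) :
    μ {x | dF ψ (g x) ≤ ENNReal.ofReal ε₀} ≤ ENNReal.ofReal (cα * ε₀ ^ α) := by
  have hc : ContinuousAt (fun t : ℝ => ENNReal.ofReal (cα * t ^ α)) ε₀ :=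
    ENNReal.continuous_ofReal.continuousAt.comp
      (continuousAt_const.mul (Real.continuousAt_rpow_const _ _ (Or.inl hε₀.ne')))
  have ht : Filter.Tendsto (fun t : ℝ => ENNReal.ofReal (cα * t ^ α))
      (nhdsWithin ε₀ (Set.Ioi ε₀)) (nhds (ENNReal.ofReal (cα * ε₀ ^ α))) :=
    hc.tendsto.mono_left nhdsWithin_le_nhds
  refine ge_of_tendsto ht ?_
  filter_upwards [self_mem_nhdsWithin] with t ht
  have ht' : ε₀ < t := ht
  refine (measure_mono ?_).trans (hlow t (hε₀.trans ht'))
  intro x hx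
  exact lt_of_le_of_lt hx ((ENNReal.ofReal_lt_ofReal_iff (hε₀.trans ht')).2 ht')

/-- **Handling bias in concentration inequalities**: if the surrogate estimates deviate from
the target by at most `ε₀` (with probability one, expressed as a degenerate tail bound), then
under the `α`-margin condition the expected excess risk is bounded by `2 cψ cα ε₀^(α+1)`. -/
theorem rates_biased_concentration
    (ψ : Z → H) (φ : Y → H) (cψ : ℝ) (hψ : ∀ z, ‖ψ z‖ ≤ cψ) (hφ : Measurable φ)
    (μ : Measure X) [IsProbabilityMeasure μ] (κ : Kernel X Y) [IsMarkovKernel κ]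
    (hφ2 : Integrable (fun p : X × Y => ‖φ p.2‖ ^ 2) (μ ⊗ₘ κ))
    (α cα : ℝ) (hα : 0 < α) (hcα : 0 < cα)
    (hlowdensity : ∀ t : ℝ, 0 < t →
      μ {x | dF ψ (gStar φ κ x) < ENNReal.ofReal t} ≤ ENNReal.ofReal (cα * t ^ α))
    (P : Measure Ω) [IsProbabilityMeasure P]
    (gn : Ω → X → H) (hgn : Measurable (Function.uncurry gn))
    (ε₀ : ℝ) (hε₀ : 0 < ε₀)
    (hconc : ∀ t : ℝ, 0 < t → ∀ x ∈ msupp μ,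
      P {ω | t < ‖gn ω x - gStar φ κ x‖} ≤ if t < ε₀ then 1 else 0)
    (fn : Ω → X → Z) (hfn : ∀ ω, IsDecoding ψ (gn ω) (fn ω))
    (hfnm : Measurable (Function.uncurry fn))
    (fstar : X → Z) (hfstar : IsDecoding ψ (gStar φ κ) fstar) :
    (∫ ω, risk ψ φ (μ ⊗ₘ κ) (fn ω) ∂P) - risk ψ φ (μ ⊗ₘ κ) fstar
      ≤ 2 * cψ * cα * ε₀ ^ (α + 1) := by
  have hi := aux_phi_int φ hφ μ κ hφ2
  have hgm := aux_gStar_meas φ hφ κ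
  have hψm : Measurable ψ := measurable_of_finite ψ
  have hcψ : 0 ≤ cψ := (norm_nonneg _).trans (hψ (Classical.arbitrary Z))
  set g := gStar φ κ with hg
  let S : Set X := {x | dF ψ (g x) ≤ ENNReal.ofReal ε₀}
  have hS : MeasurableSet S :=
    measurableSet_le (Metric.continuous_infEDist.measurable.comp hgm) measurable_const
  have hμS : μ.real S ≤ cα * ε₀ ^ α := by
    refine ENNReal.toReal_le_of_le_ofReal (by positivity) ?_
    exact aux_low ψ g μ α cα hcα hlowdensity ε₀ hε₀
  have hae : ∀ᵐ ω ∂P, ∀ᵐ x ∂μ, ‖gn ω x - g x‖ ≤ ε₀ := by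
    rw [Measure.ae_ae_comm]
    · filter_upwards [aux_msupp μ] with x hx
      have := hconc ε₀ hε₀ x hx
      simp only [lt_irrefl, if_false, nonpos_iff_eq_zero] at this
      rw [ae_iff]
      simpa only [not_le] using this
    · exact measurableSet_le (hgn.sub (hgm.comp measurable_snd)).norm measurable_const
  obtain ⟨his, hrs⟩ := aux_risk ψ φ cψ hψ hφ μ κ hi fstar hfstar.1
  have hbound : ∀ᵐ ω ∂P, risk ψ φ (μ ⊗ₘ κ) (fn ω) ≤
      risk ψ φ (μ ⊗ₘ κ) fstar + 2 * cψ * cα * ε₀ ^ (α + 1) := by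
    filter_upwards [hae] with ω hω
    obtain ⟨hin, hrn⟩ := aux_risk ψ φ cψ hψ hφ μ κ hi (fn ω) (hfn ω).1
    rw [hrn, hrs]
    have key : ∫ x, (⟪ψ (fn ω x), g x⟫ - ⟪ψ (fstar x), g x⟫) ∂μ
        ≤ ∫ x, S.indicator (fun _ => 2 * cψ * ε₀) x ∂μ := by
      refine integral_mono_ae (hin.sub his) ((integrable_const _).indicator hS) ?_
      filter_upwards [hω] with x hx
      by_cases hne : fstar x = fn ω x
      · simp only [hne, sub_self]
        exact Set.indicator_nonneg (fun _ _ => by positivity) _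
      · have hxS : x ∈ S :=
          (aux_dF_le ψ (g x) (gn ω x) _ _ hne (hfstar.2 x) ((hfn ω).2 x)).trans
            (ENNReal.ofReal_le_ofReal hx)
        rw [Set.indicator_of_mem hxS]
        have h1 := (hfn ω).2 x (fstar x)
        have h2 : ⟪ψ (fn ω x) - ψ (fstar x), g x - gn ω x⟫ ≤ (2 * cψ) * ε₀ := by
          refine (real_inner_le_norm _ _).trans ?_
          refine mul_le_mul ?_ ?_ (norm_nonneg _) (by positivity)
          · refine (norm_sub_le _ _).trans ?_
            linarith [hψ (fn ω x), hψ (fstar x)]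
          · rw [norm_sub_rev]; exact hx
        simp only [inner_sub_left, inner_sub_right] at h2
        linarith
    rw [integral_sub hin his, integral_indicator_const _ hS, smul_eq_mul] at key
    have h3 : μ.real S * (2 * cψ * ε₀) ≤ (cα * ε₀ ^ α) * (2 * cψ * ε₀) :=
      mul_le_mul_of_nonneg_right hμS (by positivity)
    rw [Real.rpow_add hε₀, Real.rpow_one]
    linarith
  have hrint : Integrable (fun ω => risk ψ φ (μ ⊗ₘ κ) (fn ω)) P := by
    refine Integrable.of_bound (C := cψ * ∫ p, ‖φ p.2‖ ∂(μ ⊗ₘ κ)) ?_ ?_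
    · have hm : Measurable (fun q : Ω × (X × Y) => ⟪ψ (fn q.1 q.2.1), φ q.2.2⟫) := by
        refine Measurable.inner (hψm.comp ?_) (hφ.comp (measurable_snd.comp measurable_snd))
        exact hfnm.comp (measurable_fst.prodMk (measurable_fst.comp measurable_snd))
      exact (hm.stronglyMeasurable.integral_prod_right' (ν := μ ⊗ₘ κ)).aestronglyMeasurable
    · refine Filter.Eventually.of_forall fun ω => ?_
      rw [← integral_const_mul]
      refine norm_integral_le_of_norm_le (hi.norm.const_mul cψ) ?_
      refine Filter.Eventually.of_forall fun p => ?_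
      exact (norm_inner_le_norm _ _).trans
        (mul_le_mul_of_nonneg_right (hψ _) (norm_nonneg _))
  have := integral_mono_ae hrint (integrable_const _) hbound
  simp only [integral_const, probReal_univ, one_smul] at this
  linarith

end
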